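/- arXiv:1105.5355 — 8 statements merged into one kernel-verified Lean document; each statement's English description precedes it below -/
import Mathlib

section
/- Let U ⊆ ℝ^n and W ⊆ ℝ^k be open with k ≤ n, and let h : U → W be continuously differentiable with Jacobian of full rank k at every point of U. If the functions f_s : W → ℝ (s = 1, 2, ...) are locally linearly independent in W, then the composed functions f_s ∘ h are locally linearly independent in U. -/
open MeasureTheory

/-- A family of functions is linearly independent (in the a.e. sense) on `U`. -/
def LinIndepAEOn {d : ℕ} {ι : Type*} (U : Set (Fin d → ℝ)) (f : ι → (Fin d → ℝ) → ℝ) : Prop :=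
  ∀ (T : Finset ι) (α : ι → ℝ),
    (∀ᵐ x ∂(volume : Measure (Fin d → ℝ)), x ∈ U → ∑ i ∈ T, α i * f i x = 0) →
    ∀ i ∈ T, α i = 0

/-- A family of functions is locally linearly independent on `U`. -/
def LocLinIndepOn {d : ℕ} {ι : Type*} (U : Set (Fin d → ℝ)) (f : ι → (Fin d → ℝ) → ℝ) : Prop :=
  ∀ W : Set (Fin d → ℝ), W ⊆ U → IsOpen W → W.Nonempty → LinIndepAEOn W f

open Filter Topology in
/-- A property that holds almost everywhere for a translation-invariant measure holds, for almost
every translate of a measurable map `R : F → E`, almost everywhere along that translate. -/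
theorem ae_ae_add_apply_of_ae {E F : Type*}
    [AddGroup E] [MeasurableSpace E] [MeasurableAdd₂ E]
    [MeasurableSpace F] {μ : Measure E} [SFinite μ] [μ.IsAddRightInvariant]
    {ν : Measure F} [SFinite ν] {R : F → E} (hR : Measurable R)
    {p : E → Prop} (hp : ∀ᵐ x ∂μ, p x) :
    ∀ᵐ x ∂μ, ∀ᵐ y ∂ν, p (x + R y) := by
  obtain ⟨N, hpN, hN, hN0⟩ := exists_measurable_superset_of_null (ae_iff.1 hp)
  have hmeas : MeasurableSet {q : E × F | q.1 + R q.2 ∈ Nᶜ} :=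
    (measurable_fst.add (hR.comp measurable_snd)) hN.compl
  have key : ∀ᵐ x ∂μ, ∀ᵐ y ∂ν, x + R y ∈ Nᶜ := by
    rw [Measure.ae_ae_comm hmeas]
    refine Eventually.of_forall fun y => ?_
    exact (measurePreserving_add_right μ (R y)).quasiMeasurePreserving.ae
      (compl_mem_ae_iff.2 hN0)
  filter_upwards [key] with x hx
  filter_upwards [hx] with y hy
  by_contra hc
  exact hy (hpN hc)

open Filter Topology in
/-- If `h` is `C¹` and submersive on a nonempty open set `V`, and `p ∘ h` holds almost everywhere
on `V`, then `p` holds almost everywhere on some nonempty open subset of `h '' V`. -/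
theorem exists_isOpen_ae_of_ae_comp {E F : Type*}
    [NormedAddCommGroup E] [NormedSpace ℝ E] [FiniteDimensional ℝ E]
    [MeasurableSpace E] [BorelSpace E]
    [NormedAddCommGroup F] [NormedSpace ℝ F] [FiniteDimensional ℝ F]
    [MeasurableSpace F] [BorelSpace F]
    {μ : Measure E} [μ.IsAddHaarMeasure] {ν : Measure F} [ν.IsAddHaarMeasure]
    {h : E → F} {V : Set E} (hV : IsOpen V) (hVne : V.Nonempty)
    (hC1 : ContDiffOn ℝ 1 h V) (hsurj : ∀ x ∈ V, Function.Surjective (fderiv ℝ h x))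
    {p : F → Prop} (hp : ∀ᵐ x ∂μ, x ∈ V → p (h x)) :
    ∃ O ⊆ h '' V, IsOpen O ∧ O.Nonempty ∧ ∀ᵐ y ∂ν, y ∈ O → p y := by
  have : CompleteSpace F := FiniteDimensional.complete ℝ F
  obtain ⟨a, ha⟩ := hVne
  obtain ⟨R₀, hR₀⟩ := (fderiv ℝ h a : E →ₗ[ℝ] F).exists_rightInverse_of_surjective
    (LinearMap.range_eq_top.2 (hsurj a ha))
  let R : F →L[ℝ] E := LinearMap.toContinuousLinearMap R₀
  have hR : (fderiv ℝ h a).comp R = 1 := by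
    ext y
    exact LinearMap.congr_fun hR₀ y
  have hcont : ContinuousAt (fun x => (fderiv ℝ h x).comp R) a :=
    ((hC1.continuousOn_fderiv_of_isOpen hV le_rfl).continuousAt (hV.mem_nhds ha)).clm_comp
      continuousAt_const
  have hunit : ∀ᶠ x in 𝓝 a, IsUnit ((fderiv ℝ h x).comp R) :=
    hcont.eventually (Units.isOpen.mem_nhds (by simp [hR]))
  obtain ⟨x, ⟨hxu, hxV⟩, hx⟩ : ∃ x, (IsUnit ((fderiv ℝ h x).comp R) ∧ x ∈ V) ∧
      ∀ᵐ y ∂ν, x + R y ∈ V → p (h (x + R y)) := by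
    have hfreq : ∃ᶠ x in ae μ, IsUnit ((fderiv ℝ h x).comp R) ∧ x ∈ V := by
      rw [frequently_ae_iff]
      exact (Measure.measure_pos_of_mem_nhds μ (hunit.and (hV.mem_nhds ha))).ne'
    exact (hfreq.and_eventually
      (ae_ae_add_apply_of_ae (ν := ν) R.continuous.measurable hp)).exists
  let k : F → F := fun y => h (x + R y)
  let S : Set F := {y | x + R y ∈ V}
  have hS : IsOpen S := hV.preimage (continuous_const.add R.continuous)
  have h0S : (0 : F) ∈ S := by simpa [S] using hxV
  have haff : ∀ y, HasStrictFDerivAt (fun y => x + R y) R y := fun y =>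
    R.hasStrictFDerivAt.const_add x
  have hk : ∀ y ∈ S, HasStrictFDerivAt k ((fderiv ℝ h (x + R y)).comp R) y := fun y hy =>
    ((hC1.contDiffAt (hV.mem_nhds hy)).hasStrictFDerivAt one_ne_zero).comp y (haff y)
  have hk0 : map k (𝓝 0) = 𝓝 (k 0) := by
    refine (hk 0 h0S).map_nhds_eq_of_surj (LinearMap.range_eq_top.2 ?_)
    obtain ⟨u, hu⟩ := hxu
    intro z
    refine ⟨(↑u⁻¹ : F →L[ℝ] F) z, ?_⟩
    have hinv := congrArg (fun A : F →L[ℝ] F => A z) u.mul_inv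
    simpa [hu] using hinv
  have hnull : ν (k '' {y | ¬ (y ∈ S → p (k y))}) = 0 := by
    refine addHaar_image_eq_zero_of_differentiableOn_of_addHaar_eq_zero ν (fun y hy => ?_)
      (ae_iff.1 hx)
    exact (hk y (Classical.not_imp.1 hy).1).hasFDerivAt.differentiableAt.differentiableWithinAt
  refine ⟨interior (k '' S), interior_subset.trans ?_, isOpen_interior, ⟨k 0, ?_⟩, ?_⟩
  · rintro _ ⟨y, hy, rfl⟩
    exact ⟨_, hy, rfl⟩
  · rw [mem_interior_iff_mem_nhds, ← hk0]
    exact image_mem_map (hS.mem_nhds h0S)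
  · filter_upwards [compl_mem_ae_iff.2 hnull] with z hz hzO
    obtain ⟨y, hy, rfl⟩ := interior_subset hzO
    by_contra hc
    exact hz ⟨y, fun hyp => hc (hyp hy), rfl⟩

theorem stmt6 {n k : ℕ} (hk : k ≤ n)
    (U : Set (Fin n → ℝ)) (W : Set (Fin k → ℝ)) (hU : IsOpen U) (hW : IsOpen W)
    (h : (Fin n → ℝ) → (Fin k → ℝ)) (hmaps : Set.MapsTo h U W)
    (hC1 : ContDiffOn ℝ 1 h U)
    -- the Jacobian of `h` has full rank `k` at every point of `U`,
    -- i.e. the derivative is surjective onto `ℝ^k`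
    (hjac : ∀ x ∈ U, Function.Surjective (fderiv ℝ h x))
    (f : ℕ → (Fin k → ℝ) → ℝ) (hf : LocLinIndepOn W f) :
    LocLinIndepOn U (fun s => f s ∘ h) := by
  intro V hVU hV hVne T α hα
  obtain ⟨O, hOV, hO, hOne, hOα⟩ := exists_isOpen_ae_of_ae_comp (ν := volume)
    (p := fun y => ∑ i ∈ T, α i * f i y = 0) hV hVne (hC1.mono hVU)
    (fun x hx => hjac x (hVU hx)) hα
  exact hf O (hOV.trans (hmaps.mono_left hVU).image_subset) hO hOne T α hOα
end

section
/- Let U ⊆ ℝ^n be open and let f_1,...,f_k : U → ℝ be locally linearly independent in U. Then for any nonempty open subsets U_1,...,U_k ⊆ U there exist points x_1 ∈ U_1, ..., x_k ∈ U_k such that the k×k matrix (f_i(x_j))_{i,j=1}^k has rank k (equivalently, nonzero determinant). -/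
open MeasureTheory

/-- Given at most `finrank K V` spanning sets, one can pick one vector from each of them so that the
chosen vectors are linearly independent. -/
theorem exists_linearIndependent_of_span_eq_top {K V : Type*} [DivisionRing K] [AddCommGroup V]
    [Module K V] [FiniteDimensional K V] {m : ℕ} (hm : m ≤ Module.finrank K V)
    (S : Fin m → Set V) (hS : ∀ j, Submodule.span K (S j) = ⊤) :
    ∃ v : Fin m → V, (∀ j, v j ∈ S j) ∧ LinearIndependent K v := by
  induction m with
  | zero => exact ⟨Fin.elim0, fun j => j.elim0, linearIndependent_empty_type⟩
  | succ m ih =>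
    obtain ⟨v, hvS, hv⟩ := ih (by omega) (fun j => S j.castSucc) (fun j => hS _)
    have hlt : Submodule.span K (Set.range v) ≠ ⊤ := by
      intro h
      have hcard := finrank_range_le_card (R := K) v
      rw [Set.finrank, h, finrank_top, Fintype.card_fin] at hcard
      omega
    obtain ⟨w, hwS, hw⟩ : ∃ w ∈ S (Fin.last m), w ∉ Submodule.span K (Set.range v) := by
      by_contra! h
      exact hlt (top_le_iff.1 (hS (Fin.last m) ▸ Submodule.span_le.2 h))
    refine ⟨Fin.snoc v w, fun j => ?_, linearIndependent_finSnoc.2 ⟨hv, hw⟩⟩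
    induction j using Fin.lastCases with
    | last => simpa using hwS
    | cast j => simpa using hvS j

/-- The evaluation vectors of a linearly independent family of functions span. -/
theorem LinIndepAEOn.span_image_eq_top {d : ℕ} {ι : Type*} [Fintype ι] {W : Set (Fin d → ℝ)}
    {f : ι → (Fin d → ℝ) → ℝ} (hf : LinIndepAEOn W f) :
    Submodule.span ℝ ((fun x i => f i x) '' W) = ⊤ := by
  classical
  by_contra h
  obtain ⟨φ, hφ, hle⟩ := Submodule.exists_le_ker_of_lt_top _ (lt_top_iff_ne_top.2 h)
  have hα := hf Finset.univ (fun i => φ (Pi.single i 1)) <| .of_forall fun x hx => by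
    have h0 : φ (fun i => f i x) = 0 := hle (Submodule.subset_span ⟨x, hx, rfl⟩)
    rw [LinearMap.pi_apply_eq_sum_univ] at h0
    rw [← h0]
    refine Finset.sum_congr rfl fun i _ => ?_
    rw [mul_comm, smul_eq_mul]
    congr 2
    funext j
    simp [Pi.single_apply, eq_comm]
  exact hφ (LinearMap.pi_ext' fun i => LinearMap.ext_ring (by simpa using hα i (Finset.mem_univ i)))

theorem stmt8 {n k : ℕ} (U : Set (Fin n → ℝ)) (hU : IsOpen U)
    (f : Fin k → (Fin n → ℝ) → ℝ) (hf : LocLinIndepOn U f)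
    (Us : Fin k → Set (Fin n → ℝ))
    (hUs : ∀ i, IsOpen (Us i) ∧ (Us i).Nonempty ∧ Us i ⊆ U) :
    ∃ x : Fin k → (Fin n → ℝ), (∀ j, x j ∈ Us j) ∧
      (Matrix.of fun i j => f i (x j)).det ≠ 0 := by
  obtain ⟨v, hvS, hv⟩ := exists_linearIndependent_of_span_eq_top (K := ℝ) (V := Fin k → ℝ)
    (by simp) (fun j => (fun x i => f i x) '' Us j) fun j =>
      (hf _ (hUs j).2.2 (hUs j).1 (hUs j).2.1).span_image_eq_top
  choose x hxU hxv using hvS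
  refine ⟨x, hxU, ?_⟩
  rw [← Matrix.det_transpose, ← isUnit_iff_ne_zero, ← Matrix.isUnit_iff_isUnit_det,
    ← Matrix.linearIndependent_rows_iff_isUnit]
  rw [← (funext hxv : (fun j i => f i (x j)) = v)] at hv
  exact hv
end

section
/- Let U, V ⊆ ℝ^n be open connected sets and let ψ : U × V → ℝ be analytic in U × V, meaning that for every p ∈ V there are Taylor functions c_s : U → ℝ (s ∈ ℕ^n), each real analytic in U, such that Σ_s c_s(x)(y−p)^s converges to ψ(x,y) for all (x,y) ∈ U × V. Then ψ has full rank almost everywhere in U × V if and only if for every p ∈ V and every k ∈ ℕ there exist k Taylor functions c_{s_1},...,c_{s_k} of ψ at p that are locally linearly independent in U. -/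
open MeasureTheory

/-- `ψ` has full rank almost everywhere in `U × V`. -/
def FullRankAE {d : ℕ} (U V : Set (Fin d → ℝ)) (ψ : (Fin d → ℝ) → (Fin d → ℝ) → ℝ) : Prop :=
  ∀ (k : ℕ) (Us Vs : Fin k → Set (Fin d → ℝ)),
    (∀ i, IsOpen (Us i) ∧ (Us i).Nonempty ∧ Us i ⊆ U) →
    (∀ j, IsOpen (Vs j) ∧ (Vs j).Nonempty ∧ Vs j ⊆ V) →
    ∃ x y : Fin k → (Fin d → ℝ), (∀ i, x i ∈ Us i) ∧ (∀ j, y j ∈ Vs j) ∧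
      (Matrix.of fun i j => ψ (x i) (y j)).det ≠ 0

/-- If a power series in several variables, summed over multi-indices, vanishes in a neighbourhood
of its centre, then all its coefficients vanish. -/
theorem coeff_eq_zero_of_hasSum_zero {n : ℕ} {V : Set (Fin n → ℝ)} (hV : IsOpen V)
    {p : Fin n → ℝ} (hp : p ∈ V) {a : (Fin n → ℕ) → ℝ}
    (ha : ∀ y ∈ V, HasSum (fun s : Fin n → ℕ => a s * ∏ i, (y i - p i) ^ s i) 0)
    (s : Fin n → ℕ) : a s = 0 := by
  obtain ⟨ε, hε, hball⟩ := Metric.isOpen_iff.1 hV p hp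
  set d := ∑ i, s i with hd
  let P : MvPolynomial (Fin n) ℝ := ∑ u ∈ Finset.piAntidiag Finset.univ d,
    MvPolynomial.monomial (Finsupp.equivFunOnFinite.symm u) (a u)
  have hP_eval (z : Fin n → ℝ) : MvPolynomial.eval z P =
      ∑ u ∈ Finset.piAntidiag Finset.univ d, a u * ∏ i, z i ^ u i := by
    simp [P, MvPolynomial.eval_monomial, Finsupp.prod_fintype]
  have hP : P = 0 := by
    refine MvPolynomial.funext_set (fun _ => Set.Ioo (-ε) ε)
      (fun _ => Set.Ioo_infinite (by linarith)) fun z hz => ?_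
    rw [hP_eval, map_zero]
    let q : FormalMultilinearSeries ℝ ℝ ℝ := FormalMultilinearSeries.ofScalars ℝ
      fun m => ∑ u ∈ Finset.piAntidiag Finset.univ m, a u * ∏ i, z i ^ u i
    have hq : HasFPowerSeriesAt 0 q (0 : ℝ) := by
      rw [hasFPowerSeriesAt_iff]
      have h1 : ∀ᶠ t : ℝ in nhds 0, |t| < 1 :=
        continuous_abs.tendsto' 0 0 abs_zero |>.eventually_lt_const one_pos
      filter_upwards [h1] with t ht
      have hy : p + t • z ∈ V := by
        refine hball ?_
        rw [Metric.mem_ball, dist_eq_norm, add_sub_cancel_left, pi_norm_lt_iff hε]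
        intro i
        have hzi : |z i| < ε := abs_lt.2 (hz i (Set.mem_univ i))
        simp only [Pi.smul_apply, smul_eq_mul, norm_mul, Real.norm_eq_abs]
        nlinarith [abs_nonneg t, abs_nonneg (z i)]
      have hsum := ((Equiv.sigmaFiberEquiv fun u : Fin n → ℕ => ∑ i, u i).hasSum_iff.2
        (ha _ hy)).sigma (g := fun m => t ^ m • q.coeff m) ?_
      · simpa using hsum
      · intro m
        have hfib := ((Equiv.subtypeEquivRight fun u : Fin n → ℕ =>
          show ∑ i, u i = m ↔ u ∈ Finset.piAntidiag Finset.univ m by simp).hasSum_iff.2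
          (Finset.hasSum (Finset.piAntidiag (Finset.univ : Finset (Fin n)) m)
            fun u => a u * ∏ i, ((p + t • z) i - p i) ^ u i))
        convert hfib using 1
        · rfl
        rw [FormalMultilinearSeries.coeff_ofScalars, smul_eq_mul, Finset.mul_sum]
        refine Finset.sum_congr rfl fun u hu => ?_
        have hum : ∑ i, u i = m := (Finset.mem_piAntidiag.1 hu).1
        simp only [Pi.add_apply, Pi.smul_apply, smul_eq_mul, add_sub_cancel_left, mul_pow,
          Finset.prod_mul_distrib, Finset.prod_pow_eq_pow_sum, hum]
        ring
    have h0 : q.coeff d = 0 := by rw [hq.eq_zero]; rfl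
    simpa [q, FormalMultilinearSeries.coeff_ofScalars] using h0
  have hcoeff : MvPolynomial.coeff (Finsupp.equivFunOnFinite.symm s) P = a s := by
    simp [P, MvPolynomial.coeff_sum, MvPolynomial.coeff_monomial, hd]
  rw [← hcoeff, hP, MvPolynomial.coeff_zero]

/-- Finitely many vectors outnumbering the coordinates satisfy a nontrivial linear relation. -/
theorem exists_sum_mul_eq_zero_of_card_lt {ι κ : Type*} [Fintype ι] [Fintype κ]
    (h : Fintype.card κ < Fintype.card ι) (w : ι → κ → ℝ) :
    ∃ α : ι → ℝ, α ≠ 0 ∧ ∀ j, ∑ i, α i * w i j = 0 := by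
  have hw : ¬ LinearIndependent ℝ w := fun hli => by
    have := hli.fintype_card_le_finrank
    simp only [Module.finrank_fintype_fun_eq_card] at this
    omega
  obtain ⟨α, hα, i, hi⟩ := Fintype.not_linearIndependent_iff.1 hw
  refine ⟨α, fun h0 => hi (congrFun h0 i), fun j => ?_⟩
  simpa [Finset.sum_apply] using congrFun hα j

/-- On a connected open set, linearly independent analytic functions are locally linearly
independent. -/
theorem locLinIndepOn_of_linearIndependent {d : ℕ} {ι : Type*} {U : Set (Fin d → ℝ)}
    (hUc : IsConnected U) {f : ι → (Fin d → ℝ) → ℝ}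
    (hf : ∀ i, AnalyticOnNhd ℝ (f i) U)
    (hli : LinearIndependent ℝ fun i (x : U) => f i x) : LocLinIndepOn U f := by
  intro W hWU hW hWne T α hα
  have hg : AnalyticOnNhd ℝ (fun x => ∑ i ∈ T, α i * f i x) U := fun x hx =>
    Finset.analyticAt_fun_sum T fun i _ => analyticAt_const.mul (hf i x hx)
  have hgW : Set.EqOn (fun x => ∑ i ∈ T, α i * f i x) 0 W := by
    refine Measure.eqOn_open_of_ae_eq (μ := volume) ?_ hW
      (hg.continuousOn.mono hWU) continuousOn_const
    exact (ae_restrict_iff' hW.measurableSet).2 hα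
  obtain ⟨w, hw⟩ := hWne
  have hgU := hg.eqOn_zero_of_preconnected_of_eventuallyEq_zero hUc.isPreconnected (hWU hw)
    (Filter.eventuallyEq_of_mem (hW.mem_nhds hw) hgW)
  refine linearIndependent_iff'.1 hli T α ?_
  funext x
  simpa [Finset.sum_apply] using hgU x.2

/-- If some `k × k` matrix of values of `ψ` is nonsingular, then `k` of its Taylor functions at `p`
are linearly independent. -/
theorem exists_linearIndependent_taylor {n : ℕ} {U V : Set (Fin n → ℝ)}
    {ψ : (Fin n → ℝ) → (Fin n → ℝ) → ℝ} {p : Fin n → ℝ} {c : (Fin n → ℕ) → (Fin n → ℝ) → ℝ}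
    (hc : ∀ x ∈ U, ∀ y ∈ V, HasSum (fun s : Fin n → ℕ => c s x * ∏ i, (y i - p i) ^ s i) (ψ x y))
    {k : ℕ} {x y : Fin k → Fin n → ℝ} (hx : ∀ i, x i ∈ U) (hy : ∀ j, y j ∈ V)
    (hdet : (Matrix.of fun i j => ψ (x i) (y j)).det ≠ 0) :
    ∃ idx : Fin k → (Fin n → ℕ), Function.Injective idx ∧
      LinearIndependent ℝ fun j (x : U) => c (idx j) x := by
  obtain ⟨κ, a, ha, hspan, hli⟩ := exists_linearIndependent' ℝ fun s (x : U) => c s x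
  by_cases hκ : Nonempty (Fin k ↪ κ)
  · obtain ⟨e⟩ := hκ
    exact ⟨a ∘ e, ha.comp e.injective, hli.comp e e.injective⟩
  · refine absurd ?_ hdet
    have hfin : Finite κ := by
      by_contra hinf
      rw [not_finite_iff_infinite] at hinf
      exact hκ ⟨Fin.valEmbedding.trans (Infinite.natEmbedding κ)⟩
    have := Fintype.ofFinite κ
    have hcard : Fintype.card κ < Fintype.card (Fin k) := by
      by_contra! hle
      exact hκ (Function.Embedding.nonempty_of_card_le hle)
    obtain ⟨l, hl, hl0⟩ := exists_sum_mul_eq_zero_of_card_lt hcard fun i j => c (a j) (x i)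
    let L : (U → ℝ) →ₗ[ℝ] ℝ := ∑ i, l i • LinearMap.proj ⟨x i, hx i⟩
    have hL (f : U → ℝ) : L f = ∑ i, l i * f ⟨x i, hx i⟩ := by simp [L]
    have hker : Submodule.span ℝ (Set.range fun s (x : U) => c s x) ≤ LinearMap.ker L := by
      rw [← hspan, Submodule.span_le]
      rintro _ ⟨j, rfl⟩
      simpa [hL] using hl0 j
    have hc0 (s : Fin n → ℕ) : ∑ i, l i * c s (x i) = 0 := by
      rw [← hL fun x => c s x]
      exact hker (Submodule.subset_span ⟨s, rfl⟩)
    refine Matrix.exists_vecMul_eq_zero_iff.1 ⟨l, hl, funext fun j => ?_⟩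
    have h1 : HasSum (fun s => ∑ i, l i * (c s (x i) * ∏ m, (y j m - p m) ^ s m))
        (∑ i, l i * ψ (x i) (y j)) :=
      hasSum_sum fun i _ => (hc (x i) (hx i) (y j) (hy j)).mul_left (l i)
    have h2 : HasSum (fun s => ∑ i, l i * (c s (x i) * ∏ m, (y j m - p m) ^ s m)) 0 := by
      convert hasSum_zero with s
      simp_rw [← mul_assoc, ← Finset.sum_mul, hc0, zero_mul]
    simpa [Matrix.vecMul, dotProduct] using h1.unique h2

theorem stmt11 {n : ℕ} (U V : Set (Fin n → ℝ)) (hU : IsOpen U) (hV : IsOpen V)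
    (hUc : IsConnected U) (hVc : IsConnected V)
    (ψ : (Fin n → ℝ) → (Fin n → ℝ) → ℝ)
    -- `c p s` is the Taylor function of `ψ` at `p ∈ V` for the multi-index `s`;
    -- each Taylor function is real analytic on `U` and the Taylor series of `ψ` at `p`
    -- converges to `ψ x y` for all `x ∈ U`, `y ∈ V`.
    (c : (Fin n → ℝ) → (Fin n → ℕ) → (Fin n → ℝ) → ℝ)
    (hanal : ∀ p ∈ V, ∀ s : Fin n → ℕ, AnalyticOnNhd ℝ (c p s) U)
    (hc : ∀ p ∈ V, ∀ x ∈ U, ∀ y ∈ V,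
      HasSum (fun s : Fin n → ℕ => c p s x * ∏ i, (y i - p i) ^ s i) (ψ x y)) :
    FullRankAE U V ψ ↔
      ∀ p ∈ V, ∀ k : ℕ, ∃ idx : Fin k → (Fin n → ℕ), Function.Injective idx ∧
        LocLinIndepOn U (fun j => c p (idx j)) := by
  constructor
  · intro h p hp k
    obtain ⟨x, y, hx, hy, hdet⟩ := h k (fun _ => U) (fun _ => V)
      (fun _ => ⟨hU, hUc.nonempty, subset_rfl⟩) (fun _ => ⟨hV, hVc.nonempty, subset_rfl⟩)
    obtain ⟨idx, hinj, hli⟩ := exists_linearIndependent_taylor (hc p hp) hx hy hdet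
    exact ⟨idx, hinj, locLinIndepOn_of_linearIndependent hUc (fun j => hanal p hp (idx j)) hli⟩
  · intro h k
    induction k with
    | zero =>
      exact fun _ _ _ _ => ⟨Fin.elim0, Fin.elim0, fun i => i.elim0, fun i => i.elim0, by simp⟩
    | succ k ih =>
      intro Us Vs hUs hVs
      obtain ⟨x, y, hx, hy, hdet⟩ := ih (fun i => Us i.succ) (fun j => Vs j.succ)
        (fun i => hUs i.succ) (fun j => hVs j.succ)
      by_contra! hcon
      obtain ⟨p, hp⟩ := (hVs 0).2.1
      obtain ⟨idx, -, hloc⟩ := h p ((hVs 0).2.2 hp) (k + 1)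
      obtain ⟨α, hα, hα0⟩ := exists_sum_mul_eq_zero_of_card_lt
        (by simp : Fintype.card (Fin k) < Fintype.card (Fin (k + 1)))
        fun j i => c p (idx j) (x i)
      refine hα (funext fun j => hloc (Us 0) (hUs 0).2.2 (hUs 0).1 (hUs 0).2.1 Finset.univ α
        (Filter.Eventually.of_forall fun z hz => ?_) j (Finset.mem_univ j))
      let X : Fin (k + 1) → Fin n → ℝ := Fin.cons z x
      have hX : ∀ i, X i ∈ Us i := Fin.cases hz hx
      -- the minors along the first column of the bordered matrix
      let D : Fin (k + 1) → ℝ := fun i =>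
        (Matrix.of fun (a b : Fin k) => ψ (X (i.succAbove a)) (y b)).det
      have hrel (w : Fin n → ℝ) (hw : w ∈ Vs 0) :
          ∑ i : Fin (k + 1), (-1) ^ (i : ℕ) * D i * ψ (X i) w = 0 := by
        have hzero := hcon X (Fin.cons w y) hX (Fin.cases hw hy)
        rw [Matrix.det_succ_column_zero] at hzero
        rw [← hzero]
        refine Finset.sum_congr rfl fun i _ => ?_
        simp only [Matrix.of_apply, Fin.cons_zero]
        rw [mul_right_comm]
        rfl
      have hcoeff (s : Fin n → ℕ) : ∑ i : Fin (k + 1), (-1) ^ (i : ℕ) * D i * c p s (X i) = 0 := by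
        refine coeff_eq_zero_of_hasSum_zero (hVs 0).1 hp
          (a := fun s => ∑ i : Fin (k + 1), (-1) ^ (i : ℕ) * D i * c p s (X i)) (fun w hw => ?_) s
        rw [← hrel w hw]
        simp_rw [Finset.sum_mul, mul_assoc ((-1) ^ _ * D _)]
        exact hasSum_sum fun i _ => (hc p ((hVs 0).2.2 hp) (X i) ((hUs i).2.2 (hX i)) w
          ((hVs 0).2.2 hw)).mul_left _
      have hD : D 0 ≠ 0 := hdet
      refine (mul_eq_zero_iff_left hD).1 ?_
      have hsum : ∑ j, α j * ∑ i : Fin (k + 1), (-1) ^ (i : ℕ) * D i * c p (idx j) (X i) = 0 := by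
        simp [hcoeff]
      simp_rw [Finset.mul_sum] at hsum
      rw [Finset.sum_comm, Fin.sum_univ_succ] at hsum
      have htail (i : Fin k) : ∑ j, α j * ((-1) ^ (i.succ : ℕ) * D i.succ *
          c p (idx j) (X i.succ)) = 0 := by
        simp_rw [mul_left_comm (α _)]
        rw [← Finset.mul_sum]
        simp [X, hα0]
      simp only [htail, Finset.sum_const_zero, add_zero] at hsum
      rw [Finset.mul_sum, ← hsum]
      refine Finset.sum_congr rfl fun j _ => ?_
      simp [X]
      ring
end

section
/- Let U ⊆ ℝ^n be open and let f : U → ℝ be real analytic in U. If the zero set V_0 = {x ∈ U : f(x) = 0} has no interior points, then V_0 is Lebesgue measurable and has Lebesgue measure zero. -/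
open MeasureTheory

open Set Filter Topology

lemma AnalyticOnNhd.measurableSet_zeros {E : Type*} [NormedAddCommGroup E] [NormedSpace ℝ E]
    [MeasurableSpace E] [BorelSpace E] {U : Set E} (hU : IsOpen U) {f : E → ℝ}
    (hf : AnalyticOnNhd ℝ f U) : MeasurableSet {x ∈ U | f x = 0} := by
  have h : {x ∈ U | f x = 0} = U \ (U ∩ f ⁻¹' {0}ᶜ) := by
    ext x
    simp +contextual
  rw [h]
  exact hU.measurableSet.diff
    (hf.continuousOn.isOpen_inter_preimage hU isOpen_compl_singleton).measurableSet

/-- An analytic function of one real variable that does not vanish identically on a preconnected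
set has a null set of zeros there. -/
lemma AnalyticOnNhd.volume_zeros_eq_zero {V : Set ℝ} (hV : MeasurableSet V)
    (hVc : IsPreconnected V) {g : ℝ → ℝ} (hg : AnalyticOnNhd ℝ g V) {t₀ : ℝ} (ht₀ : t₀ ∈ V)
    (hgt₀ : g t₀ ≠ 0) : volume {t ∈ V | g t = 0} = 0 := by
  rcases hg.eqOn_zero_or_eventually_ne_zero_of_preconnected hVc with h | h
  · exact absurd (h ht₀) hgt₀
  · have h' : ∀ᵐ t ∂volume.restrict V, g t ≠ 0 := ae_restrict_le_codiscreteWithin hV h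
    rw [ae_restrict_iff' hV] at h'
    refine measure_mono_null ?_ (ae_iff.1 h')
    rintro t ⟨htV, ht⟩
    simp [htV, ht]

/-- An analytic function that does not vanish identically on an open convex set has a null set of
zeros there: almost every homothety with centre a nonzero of the function pulls the zero set back
to a null set, by Fubini's theorem along the lines through the centre. -/
lemma AnalyticOnNhd.addHaar_zeros_eq_zero_of_convex {E : Type*} [NormedAddCommGroup E]
    [NormedSpace ℝ E] [FiniteDimensional ℝ E] [MeasurableSpace E] [BorelSpace E]
    (μ : Measure E) [μ.IsAddHaarMeasure] {B : Set E} (hB : IsOpen B) (hBc : Convex ℝ B)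
    {f : E → ℝ} (hf : AnalyticOnNhd ℝ f B) {a : E} (ha : a ∈ B) (hfa : f a ≠ 0) :
    μ {x ∈ B | f x = 0} = 0 := by
  set S := {x ∈ B | f x = 0} with hS
  have hSm : MeasurableSet S := hf.measurableSet_zeros hB
  have hlines : ∀ x : E, ∀ᵐ t : ℝ, AffineMap.lineMap a x t ∉ S := fun x ↦ by
    have hline : AnalyticOnNhd ℝ (fun t : ℝ ↦ AffineMap.lineMap a x t) univ := by
      intro t _
      simp only [AffineMap.lineMap_apply_module']
      fun_prop
    have hVo : IsOpen (AffineMap.lineMap a x ⁻¹' B : Set ℝ) :=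
      hB.preimage AffineMap.lineMap_continuous
    have hVc : Convex ℝ (AffineMap.lineMap a x ⁻¹' B : Set ℝ) := hBc.affine_preimage _
    have hg : AnalyticOnNhd ℝ (fun t : ℝ ↦ f (AffineMap.lineMap a x t))
        (AffineMap.lineMap a x ⁻¹' B) :=
      hf.comp (hline.mono (subset_univ _)) fun _ ht ↦ ht
    have h0 := hg.volume_zeros_eq_zero hVo.measurableSet hVc.isPreconnected (t₀ := 0)
      (by simpa using ha) (by simpa using hfa)
    simpa [ae_iff, hS] using h0
  have hcont : Continuous fun p : E × ℝ ↦ (AffineMap.lineMap a p.1 p.2 : E) := by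
    simp only [AffineMap.lineMap_apply_module']
    fun_prop
  have hhom : ∀ᵐ t : ℝ, ∀ᵐ x ∂μ, AffineMap.lineMap a x t ∉ S :=
    (Measure.ae_ae_comm (p := fun x t ↦ AffineMap.lineMap a x t ∉ S)
      (hcont.measurable hSm.compl)).1 (.of_forall hlines)
  obtain ⟨t, ht, ht0⟩ := (hhom.and (Measure.ae_ne volume (0 : ℝ))).exists
  have himage : S ⊆ AffineMap.homothety a t '' {x | AffineMap.lineMap a x t ∈ S} := by
    intro y hy
    have hty : AffineMap.homothety a t (t⁻¹ • (y - a) + a) = y := by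
      simp [AffineMap.homothety_apply, smul_smul, ht0]
    exact ⟨_, by simpa [← AffineMap.homothety_eq_lineMap, hty] using! hy, hty⟩
  refine measure_mono_null himage ?_
  rw [Measure.addHaar_image_homothety]
  have hnull : μ {x | AffineMap.lineMap a x t ∈ S} = 0 := by simpa [ae_iff] using ht
  rw [hnull, mul_zero]

theorem stmt14 {n : ℕ} (U : Set (Fin n → ℝ)) (hU : IsOpen U)
    (f : (Fin n → ℝ) → ℝ) (hf : AnalyticOnNhd ℝ f U)
    (hint : interior {x ∈ U | f x = 0} = ∅) :
    MeasurableSet {x ∈ U | f x = 0} ∧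
      volume {x ∈ U | f x = 0} = 0 := by
  refine ⟨hf.measurableSet_zeros hU, measure_null_of_locally_null _ ?_⟩
  rintro x ⟨hxU, -⟩
  obtain ⟨r, hr, hball⟩ := Metric.isOpen_iff.1 hU x hxU
  obtain ⟨a, ha, hfa⟩ : ∃ a ∈ Metric.ball x r, f a ≠ 0 := by
    by_contra! h
    have hx : x ∈ interior {x ∈ U | f x = 0} :=
      mem_interior.2 ⟨Metric.ball x r, fun y hy ↦ ⟨hball hy, h y hy⟩, Metric.isOpen_ball,
        Metric.mem_ball_self hr⟩
    simp [hint] at hx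
  refine ⟨{y ∈ Metric.ball x r | f y = 0}, ?_,
    (hf.mono hball).addHaar_zeros_eq_zero_of_convex volume Metric.isOpen_ball
      (convex_ball x r) ha hfa⟩
  filter_upwards [self_mem_nhdsWithin, mem_nhdsWithin_of_mem_nhds (Metric.ball_mem_nhds x hr)]
    with y hy hyr using ⟨hyr, hy.2⟩
end

section
/- Let U, V ⊆ ℝ^n be open connected sets and let ψ : U × V → ℝ be real analytic on U × V and have full rank almost everywhere in U × V. Then for every k ≥ 1 the set D_k = {(x_1,...,x_k,y_1,...,y_k) ∈ U^k × V^k : rank((ψ(x_i,y_j))_{i,j=1}^k) < k} has Lebesgue (product) measure zero in ℝ^{2nk}. -/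
open MeasureTheory

open Topology Filter

/-- The zero set of a real analytic function on a convex open set is null, unless the function
vanishes identically there. -/
theorem AnalyticOnNhd.measure_inter_zero_eq_zero_of_convex
    {E : Type*} [NormedAddCommGroup E] [NormedSpace ℝ E] [FiniteDimensional ℝ E]
    [MeasurableSpace E] [BorelSpace E] (μ : Measure E) [μ.IsAddHaarMeasure]
    {f : E → ℝ} {W : Set E} (hW : IsOpen W) (hWc : Convex ℝ W) (hf : AnalyticOnNhd ℝ f W)
    {p : E} (hpW : p ∈ W) (hp : f p ≠ 0) :
    μ (W ∩ f ⁻¹' {0}) = 0 := by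
  have hmeas : MeasurableSet (W ∩ f ⁻¹' {0}) := by
    have h : W ∩ f ⁻¹' {0} = W \ (W ∩ f ⁻¹' {0}ᶜ) := by
      ext z
      simp only [Set.mem_inter_iff, Set.mem_preimage, Set.mem_sdiff, Set.mem_compl_iff]
      tauto
    rw [h]
    exact hW.measurableSet.diff
      (hf.continuousOn.isOpen_inter_preimage hW isOpen_compl_singleton).measurableSet
  have hline : ∀ x : E, ∀ᵐ t : ℝ, AffineMap.lineMap p x t ∉ W ∩ f ⁻¹' {0} := by
    intro x
    set I : Set ℝ := (AffineMap.lineMap p x : ℝ →ᵃ[ℝ] E) ⁻¹' W with hI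
    have hcont : Continuous (AffineMap.lineMap p x : ℝ →ᵃ[ℝ] E) := AffineMap.lineMap_continuous
    have hI0 : (0 : ℝ) ∈ I := by simpa [hI] using hpW
    have hIm : MeasurableSet I := (hW.preimage hcont).measurableSet
    have hg : AnalyticOnNhd ℝ (fun t : ℝ => f (AffineMap.lineMap p x t)) I := by
      intro t ht
      have hl : AnalyticAt ℝ (fun t : ℝ => AffineMap.lineMap p x t) t := by
        simp only [AffineMap.lineMap_apply_module']
        fun_prop
      exact AnalyticAt.fun_comp (hf _ ht) hl
    have hcod := hg.preimage_zero_mem_codiscreteWithin (x := 0) (by simpa using hp) hI0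
      ⟨⟨0, hI0⟩, (hWc.affine_preimage _).isPreconnected⟩
    have hae := ae_restrict_le_codiscreteWithin (μ := (volume : Measure ℝ)) hIm hcod
    have hae' := (ae_restrict_iff' hIm).1 hae
    filter_upwards [hae'] with t ht hmem
    exact ht hmem.1 hmem.2
  have hcontp : Continuous fun q : E × ℝ => (AffineMap.lineMap p q.1 q.2 : E) := by
    simp only [AffineMap.lineMap_apply_module']
    fun_prop
  have hswap := (Measure.ae_ae_comm (μ := μ) (ν := (volume : Measure ℝ))
    (p := fun x t => (AffineMap.lineMap p x t : E) ∉ W ∩ f ⁻¹' {0})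
    (hcontp.measurable hmeas).compl).1 (ae_of_all _ hline)
  obtain ⟨t, ht, ht0⟩ := (hswap.and (Measure.ae_ne volume (0 : ℝ))).exists
  have hnull : μ {x | AffineMap.homothety p t x ∈ W ∩ f ⁻¹' {0}} = 0 := by
    have h := ae_iff.1 ht
    simpa only [not_not, AffineMap.homothety_eq_lineMap] using h
  have himage : W ∩ f ⁻¹' {0} ⊆
      AffineMap.homothety p t '' {x | AffineMap.homothety p t x ∈ W ∩ f ⁻¹' {0}} := by
    intro z hz
    have hzt : AffineMap.homothety p t (AffineMap.homothety p t⁻¹ z) = z := by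
      rw [← AffineMap.homothety_mul_apply, mul_inv_cancel₀ ht0, AffineMap.homothety_one]
      rfl
    exact ⟨AffineMap.homothety p t⁻¹ z, by simpa only [Set.mem_ofPred_eq, hzt] using hz, hzt⟩
  refine measure_mono_null himage ?_
  rw [Measure.addHaar_image_homothety, hnull, mul_zero]

/-- The determinant of `(ψ (x i) (y j))` is analytic in all variables jointly. -/
theorem AnalyticOnNhd.det_of_eval {E F : Type*} [NormedAddCommGroup E] [NormedSpace ℝ E]
    [NormedAddCommGroup F] [NormedSpace ℝ F] {ψ : E → F → ℝ} {U : Set E} {V : Set F}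
    (hψ : AnalyticOnNhd ℝ (fun p : E × F => ψ p.1 p.2) (U ×ˢ V)) (k : ℕ) :
    AnalyticOnNhd ℝ
      (fun z : (Fin k → E) × (Fin k → F) => (Matrix.of fun i j => ψ (z.1 i) (z.2 j)).det)
      {z | (∀ i, z.1 i ∈ U) ∧ ∀ j, z.2 j ∈ V} := by
  intro z hz
  simp only [Matrix.det_apply', Matrix.of_apply]
  refine Finset.analyticAt_fun_sum _ fun σ _ => analyticAt_const.mul ?_
  refine Finset.analyticAt_fun_prod _ fun i _ => ?_
  have hx : AnalyticAt ℝ (fun z : (Fin k → E) × (Fin k → F) => z.1 (σ i)) z :=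
    ((ContinuousLinearMap.proj (R := ℝ) (φ := fun _ : Fin k => E) (σ i)).comp
      (ContinuousLinearMap.fst ℝ (Fin k → E) (Fin k → F))).analyticAt z
  have hy : AnalyticAt ℝ (fun z : (Fin k → E) × (Fin k → F) => z.2 i) z :=
    ((ContinuousLinearMap.proj (R := ℝ) (φ := fun _ : Fin k => F) i).comp
      (ContinuousLinearMap.snd ℝ (Fin k → E) (Fin k → F))).analyticAt z
  exact AnalyticAt.fun_comp (g := fun p : E × F => ψ p.1 p.2)
    (f := fun z : (Fin k → E) × (Fin k → F) => (z.1 (σ i), z.2 i))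
    (hψ (z.1 (σ i), z.2 i) ⟨hz.1 _, hz.2 _⟩) (hx.prod hy)

theorem stmt15 {n : ℕ} (U V : Set (Fin n → ℝ)) (hU : IsOpen U) (hV : IsOpen V)
    (hUc : IsConnected U) (hVc : IsConnected V)
    (ψ : (Fin n → ℝ) → (Fin n → ℝ) → ℝ)
    (hψ : AnalyticOnNhd ℝ (fun p : (Fin n → ℝ) × (Fin n → ℝ) => ψ p.1 p.2) (U ×ˢ V))
    (hfr : FullRankAE U V ψ) (k : ℕ) (hk : 1 ≤ k) :
    volume {z : (Fin k → (Fin n → ℝ)) × (Fin k → (Fin n → ℝ)) |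
      (∀ i, z.1 i ∈ U) ∧ (∀ j, z.2 j ∈ V) ∧
        (Matrix.of fun i j => ψ (z.1 i) (z.2 j)).rank < k} = 0 := by
  have hdet := hψ.det_of_eval k
  have hopen : IsOpen {z : (Fin k → (Fin n → ℝ)) × (Fin k → (Fin n → ℝ)) |
      (∀ i, z.1 i ∈ U) ∧ ∀ j, z.2 j ∈ V} := by
    simp only [Set.ofPred_and, Set.ofPred_forall]
    exact (isOpen_iInter_of_finite fun i => hU.preimage (by fun_prop)).inter
      (isOpen_iInter_of_finite fun j => hV.preimage (by fun_prop))
  refine measure_null_of_locally_null _ fun z hz => ?_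
  obtain ⟨ε, hε, hball⟩ := Metric.isOpen_iff.1 hopen z ⟨hz.1, hz.2.1⟩
  have hmem : ∀ x y : Fin k → (Fin n → ℝ), (∀ i, x i ∈ Metric.ball (z.1 i) ε) →
      (∀ j, y j ∈ Metric.ball (z.2 j) ε) → (x, y) ∈ Metric.ball z ε := by
    intro x y hx hy
    rw [Metric.mem_ball, Prod.dist_eq]
    exact max_lt ((dist_pi_lt_iff hε).2 hx) ((dist_pi_lt_iff hε).2 hy)
  have hself : ∀ w : Fin k → (Fin n → ℝ), ∀ i, w i ∈ Metric.ball (w i) ε :=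
    fun w i => Metric.mem_ball_self hε
  obtain ⟨x, y, hx, hy, hxy⟩ := hfr k (fun i => Metric.ball (z.1 i) ε)
    (fun j => Metric.ball (z.2 j) ε)
    (fun i => ⟨Metric.isOpen_ball, ⟨_, hself z.1 i⟩, fun u hu => by
      have h := (hball (hmem (Function.update z.1 i u) z.2 (fun i' => by
        rcases eq_or_ne i' i with rfl | hne
        · simpa using hu
        · simpa [hne] using hε) (hself z.2))).1 i
      simpa using h⟩)
    (fun j => ⟨Metric.isOpen_ball, ⟨_, hself z.2 j⟩, fun u hu => by
      have h := (hball (hmem z.1 (Function.update z.2 j u) (hself z.1) (fun j' => by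
        rcases eq_or_ne j' j with rfl | hne
        · simpa using hu
        · simpa [hne] using hε))).2 j
      simpa using h⟩)
  have : (volume : Measure (Fin k → Fin n → ℝ)).IsAddHaarMeasure :=
    Measure.pi.isAddHaarMeasure _
  have : (volume : Measure ((Fin k → Fin n → ℝ) × (Fin k → Fin n → ℝ))).IsAddHaarMeasure :=
    Measure.prod.instIsAddHaarMeasure _ _
  refine ⟨_, ?_, (hdet.mono hball).measure_inter_zero_eq_zero_of_convex volume
    Metric.isOpen_ball (convex_ball z ε) (hmem x y hx hy) hxy⟩
  filter_upwards [mem_nhdsWithin_of_mem_nhds (Metric.ball_mem_nhds z hε), self_mem_nhdsWithin]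
    with w hw hwD
  refine ⟨hw, ?_⟩
  by_contra hne
  have hrank := Matrix.rank_of_isUnit _ ((Matrix.isUnit_iff_isUnit_det _).2 (isUnit_iff_ne_zero.2 hne))
  rw [Fintype.card_fin] at hrank
  exact hwD.2.2.ne hrank
end

section
/- Let n ≥ 2 and let S^n = {p ∈ ℝ^{n+1} : ‖p‖ = 1} be the unit sphere. The geodesic (standard) distance kernel ψ(p,q) = arccos(p·q) has full rank almost everywhere on S^n × S^n: for every k ∈ ℕ and every choice of nonempty relatively open subsets U_1,...,U_k ⊆ S^n and V_1,...,V_k ⊆ S^n there exist points p_i ∈ U_i and q_j ∈ V_j such that the k×k matrix (arccos(p_i·q_j))_{i,j=1}^k is nonsingular. -/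
open RealInnerProductSpace

/-- An open set meeting the unit sphere meets it outside any finite family of proper subspaces. -/
theorem exists_mem_sphere_inter_forall_notMem_submodule {E ι : Type*} [NormedAddCommGroup E]
    [NormedSpace ℝ E] [FiniteDimensional ℝ E] [MeasurableSpace E] [BorelSpace E] [Finite ι]
    {U : Set E} (hU : IsOpen U) (hne : (Metric.sphere (0 : E) 1 ∩ U).Nonempty)
    (W : ι → Submodule ℝ E) (hW : ∀ i, W i ≠ ⊤) :
    ∃ x ∈ Metric.sphere (0 : E) 1 ∩ U, ∀ i, x ∉ W i := by
  let T : Set E := {0}ᶜ ∩ (fun x : E => ‖x‖⁻¹ • x) ⁻¹' U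
  have hT : IsOpen T := by
    refine ContinuousOn.isOpen_inter_preimage ?_ isOpen_compl_singleton hU
    exact (continuousOn_id.norm.inv₀ fun x hx => norm_ne_zero_iff.2 hx).smul continuousOn_id
  have hTne : T.Nonempty := by
    obtain ⟨x, hx, hxU⟩ := hne
    have hx1 : ‖x‖ = 1 := by simpa using hx
    exact ⟨x, fun h => by simp [Set.mem_singleton_iff.1 h] at hx1, by simpa [hx1] using hxU⟩
  have hnull : (MeasureTheory.Measure.addHaar : MeasureTheory.Measure E)
      (⋃ i, (W i : Set E)) = 0 :=
    MeasureTheory.measure_iUnion_null fun i =>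
      MeasureTheory.Measure.addHaar_submodule _ (W i) (hW i)
  have hsub : ¬ T ⊆ ⋃ i, (W i : Set E) := fun h =>
    (hT.measure_pos MeasureTheory.Measure.addHaar hTne).ne'
      (MeasureTheory.measure_mono_null h hnull)
  obtain ⟨x, ⟨hx0, hxU⟩, hxW⟩ := Set.not_subset.1 hsub
  have hx0' : ‖x‖ ≠ 0 := norm_ne_zero_iff.2 hx0
  refine ⟨‖x‖⁻¹ • x, ⟨by simp [norm_smul, hx0'], hxU⟩, fun i hi => hxW ?_⟩
  exact Set.mem_iUnion.2 ⟨i, ((W i).smul_mem_iff (inv_ne_zero hx0')).1 hi⟩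

/-- The span of two vectors is proper in dimension at least three. -/
theorem span_pair_ne_top_of_two_lt_finrank {E : Type*} [AddCommGroup E] [Module ℝ E]
    (h : 2 < Module.finrank ℝ E) (x y : E) : Submodule.span ℝ {x, y} ≠ ⊤ := by
  classical
  intro htop
  have h2 := finrank_span_finset_le_card (R := ℝ) ({x, y} : Finset E)
  rw [Finset.coe_pair, Set.finrank, htop, finrank_top] at h2
  exact absurd (h2.trans Finset.card_le_two) (not_le.2 h)

section GreatCircle

variable {E : Type*} [NormedAddCommGroup E] [InnerProductSpace ℝ E]

theorem norm_cos_smul_add_sin_smul {u v : E} (hu : ‖u‖ = 1) (hv : ‖v‖ = 1) (huv : ⟪u, v⟫ = 0)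
    (t : ℝ) : ‖Real.cos t • u + Real.sin t • v‖ = 1 := by
  have h : ‖Real.cos t • u + Real.sin t • v‖ ^ 2 = 1 := by
    rw [norm_add_sq_real, norm_smul, norm_smul, inner_smul_left, inner_smul_right, huv, hu, hv]
    simp
  exact (pow_eq_one_iff_of_nonneg (norm_nonneg _) two_ne_zero).1 h

/-- The distance to a point off a great circle is analytic along the great circle. -/
theorem analyticAt_arccos_inner_cos_smul_add_sin_smul {u v w : E} (hu : ‖u‖ = 1) (hv : ‖v‖ = 1)
    (huv : ⟪u, v⟫ = 0) (hw : ‖w‖ = 1) (hmem : w ∉ Submodule.span ℝ {u, v}) (t : ℝ) :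
    AnalyticAt ℝ (fun s => Real.arccos ⟪Real.cos s • u + Real.sin s • v, w⟫) t := by
  have hn := norm_cos_smul_add_sin_smul hu hv huv t
  have hspan : Real.cos t • u + Real.sin t • v ∈ Submodule.span ℝ {u, v} :=
    Submodule.mem_span_pair.2 ⟨_, _, rfl⟩
  have h1 : ⟪Real.cos t • u + Real.sin t • v, w⟫ ≠ 1 := fun h =>
    hmem ((inner_eq_one_iff_of_norm_eq_one hn hw).1 h ▸ hspan)
  have h2 : ⟪Real.cos t • u + Real.sin t • v, w⟫ ≠ -1 := fun h => by
    rw [(inner_eq_neg_one_iff_of_norm_eq_one hn hw).1 h] at hspan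
    exact hmem (neg_mem_iff.1 hspan)
  refine ContDiffAt.analyticAt ?_
  refine ContDiffAt.comp (g := Real.arccos) t (Real.contDiffAt_arccos h2 h1) ?_
  simp only [inner_add_left, inner_smul_left]
  exact ((Real.contDiff_cos.mul contDiff_const).add
    (Real.contDiff_sin.mul contDiff_const)).contDiffAt

/-- In a linear relation between distances that holds near a point `p₀` of the sphere, the
coefficient of the distance to `q₀` vanishes if the great circle through `p₀` and `q₀` avoids the
other points. -/
theorem coeff_eq_zero_of_sum_arccos_inner_eq_zero {ι : Type*} [Fintype ι] {O : Set E}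
    (hO : IsOpen O) {p₀ q₀ : E} (hp₀ : ‖p₀‖ = 1) (hq₀ : ‖q₀‖ = 1) (hpO : p₀ ∈ O)
    (hne : p₀ ∉ Submodule.span ℝ {q₀}) {q : ι → E} (hq : ∀ i, ‖q i‖ = 1)
    (hmem : ∀ i, q i ∉ Submodule.span ℝ {q₀, p₀}) {a : ℝ} {c : ι → ℝ}
    (h : ∀ p ∈ O, ‖p‖ = 1 →
      a * Real.arccos ⟪p, q₀⟫ + ∑ i, c i * Real.arccos ⟪p, q i⟫ = 0) :
    a = 0 := by
  have hIcc := real_inner_mem_Icc_of_norm_eq_one hp₀ hq₀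
  have hne1 : ⟪p₀, q₀⟫ ≠ 1 := fun h1 =>
    hne ((inner_eq_one_iff_of_norm_eq_one hp₀ hq₀).1 h1 ▸ Submodule.mem_span_singleton_self _)
  have hne2 : ⟪p₀, q₀⟫ ≠ -1 := fun h1 => hne (by
    rw [(inner_eq_neg_one_iff_of_norm_eq_one hp₀ hq₀).1 h1]
    exact neg_mem (Submodule.mem_span_singleton_self _))
  set r := Real.arccos ⟪p₀, q₀⟫ with hr
  have hcos : Real.cos r = ⟪p₀, q₀⟫ := Real.cos_arccos hIcc.1 hIcc.2
  have hr0 : 0 < r := Real.arccos_pos.2 (lt_of_le_of_ne hIcc.2 hne1)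
  have hrpi : r < Real.pi := lt_of_le_of_ne (Real.arccos_le_pi _) fun h1 => by
    rw [h1, Real.cos_pi] at hcos
    exact hne2 hcos.symm
  have hsin : 0 < Real.sin r := Real.sin_pos_of_pos_of_lt_pi hr0 hrpi
  obtain ⟨v, hv⟩ : ∃ v, v = (Real.sin r)⁻¹ • (p₀ - Real.cos r • q₀) := ⟨_, rfl⟩
  have hp : Real.cos r • q₀ + Real.sin r • v = p₀ := by
    rw [hv, smul_inv_smul₀ hsin.ne']
    abel
  have horth : ⟪q₀, v⟫ = 0 := by
    rw [hv, inner_smul_right, inner_sub_right, inner_smul_right, real_inner_self_eq_norm_sq, hq₀,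
      hcos, real_inner_comm]
    simp
  have hvn : ‖v‖ = 1 := by
    have h1 : ‖p₀‖ ^ 2 = 1 := by rw [hp₀, one_pow]
    rw [← hp, norm_add_sq_real, norm_smul, norm_smul, inner_smul_left, inner_smul_right, horth, hq₀,
      mul_pow, mul_pow, Real.norm_eq_abs, Real.norm_eq_abs, sq_abs, sq_abs] at h1
    have h2 : Real.sin r ^ 2 * (‖v‖ ^ 2 - 1) = 0 := by
      have := Real.sin_sq_add_cos_sq r
      simp only [mul_zero, one_pow, mul_one, add_zero] at h1
      linarith
    have h3 : ‖v‖ ^ 2 = 1 := by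
      rcases mul_eq_zero.1 h2 with h | h
      · exact absurd h (pow_pos hsin 2).ne'
      · linarith
    exact (pow_eq_one_iff_of_nonneg (norm_nonneg _) two_ne_zero).1 h3
  have hmem' : ∀ i, q i ∉ Submodule.span ℝ {q₀, v} := fun i hi => hmem i <| by
    refine Submodule.span_le.2 ?_ hi
    have hq : q₀ ∈ Submodule.span ℝ {q₀, p₀} := Submodule.subset_span (by simp)
    have hpm : p₀ ∈ Submodule.span ℝ {q₀, p₀} := Submodule.subset_span (by simp)
    rintro x (rfl | rfl)
    · exact hq
    · rw [hv]
      exact Submodule.smul_mem _ _ (Submodule.sub_mem _ hpm (Submodule.smul_mem _ _ hq))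
  let γ : ℝ → E := fun t => Real.cos t • q₀ + Real.sin t • v
  let g : ℝ → ℝ := fun t => ∑ i, c i * Real.arccos ⟪γ t, q i⟫
  have hγ : Continuous γ :=
    (Real.continuous_cos.smul continuous_const).add (Real.continuous_sin.smul continuous_const)
  have hγq : ∀ t, ⟪γ t, q₀⟫ = Real.cos t := fun t => by
    simp only [γ]
    rw [inner_add_left, inner_smul_left, inner_smul_left, real_inner_comm q₀ v, horth,
      real_inner_self_eq_norm_sq, hq₀]
    simp
  have hg : AnalyticOnNhd ℝ (fun t => a * t + g t) Set.univ := fun t _ =>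
    (analyticAt_const.mul analyticAt_id).add <|
      Finset.analyticAt_fun_sum _ fun i _ => analyticAt_const.mul <|
        analyticAt_arccos_inner_cos_smul_add_sin_smul hq₀ hvn horth (hq i) (hmem' i) t
  have hloc : (fun t => a * t + g t) =ᶠ[nhds r] 0 := by
    filter_upwards [(hO.preimage hγ).mem_nhds (show γ r ∈ O from by simpa only [γ, hp] using hpO), Ioo_mem_nhds hr0 hrpi]
      with t htO ht
    have := h (γ t) htO (norm_cos_smul_add_sin_smul hq₀ hvn horth t)
    rwa [hγq, Real.arccos_cos ht.1.le ht.2.le] at this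
  have hglob : (fun t => a * t + g t) = 0 :=
    hg.eq_of_eventuallyEq (fun t _ => analyticAt_const) hloc
  have h0 := congrFun hglob 0
  have h1 := congrFun hglob (2 * Real.pi)
  have hper : g (2 * Real.pi) = g 0 := by simp [g, γ]
  simp only [Pi.zero_apply, hper] at h0 h1
  have h2 : a * (2 * Real.pi) = 0 := by linarith
  exact (mul_eq_zero.1 h2).resolve_right Real.two_pi_pos.ne'

end GreatCircle

theorem stmt16 {n : ℕ} (hn : 2 ≤ n) (k : ℕ)
    (O P : Fin k → Set (EuclideanSpace ℝ (Fin (n + 1))))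
    (hO : ∀ i, IsOpen (O i) ∧
      (Metric.sphere (0 : EuclideanSpace ℝ (Fin (n + 1))) 1 ∩ O i).Nonempty)
    (hP : ∀ j, IsOpen (P j) ∧
      (Metric.sphere (0 : EuclideanSpace ℝ (Fin (n + 1))) 1 ∩ P j).Nonempty) :
    ∃ p q : Fin k → EuclideanSpace ℝ (Fin (n + 1)),
      (∀ i, p i ∈ Metric.sphere (0 : EuclideanSpace ℝ (Fin (n + 1))) 1 ∩ O i) ∧
      (∀ j, q j ∈ Metric.sphere (0 : EuclideanSpace ℝ (Fin (n + 1))) 1 ∩ P j) ∧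
      (Matrix.of fun i j => Real.arccos ⟪p i, q j⟫).det ≠ 0 := by
  induction k with
  | zero => exact ⟨Fin.elim0, Fin.elim0, fun i => i.elim0, fun i => i.elim0, by simp⟩
  | succ k ih =>
    obtain ⟨p, q, hp, hq, hdet⟩ := ih (fun i => O i.succ) (fun j => P j.succ)
      (fun i => hO i.succ) (fun j => hP j.succ)
    have hspan := span_pair_ne_top_of_two_lt_finrank
      (E := EuclideanSpace ℝ (Fin (n + 1))) (by rw [finrank_euclideanSpace_fin]; omega)
    obtain ⟨q₀, hq₀, hq₀W⟩ := exists_mem_sphere_inter_forall_notMem_submodule (hP 0).1 (hP 0).2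
      (fun j => Submodule.span ℝ {q j, q j}) fun j => hspan _ _
    obtain ⟨p₀, hp₀, hp₀W⟩ := exists_mem_sphere_inter_forall_notMem_submodule (hO 0).1 (hO 0).2
      (fun j : Option (Fin k) => Submodule.span ℝ {j.elim q₀ q, q₀}) fun j => hspan _ _
    have hne : p₀ ∉ Submodule.span ℝ {q₀} := by simpa using hp₀W none
    have hmem : ∀ j, q j ∉ Submodule.span ℝ {q₀, p₀} := by
      intro j hj
      obtain ⟨x, y, hxy⟩ := Submodule.mem_span_pair.1 hj
      by_cases hy : y = 0
      · have hx : x ≠ 0 := by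
          rintro rfl
          have := (hq j).1
          simp [← hxy, hy] at this
        refine hq₀W j (Submodule.mem_span_pair.2 ⟨x⁻¹, 0, ?_⟩)
        simp [← hxy, hy, hx]
      · refine hp₀W (some j) (Submodule.mem_span_pair.2 ⟨y⁻¹, -(y⁻¹ * x), ?_⟩)
        simp only [Option.elim, ← hxy]
        rw [smul_add, smul_smul, smul_smul, inv_mul_cancel₀ hy]
        module
    by_contra! hcon
    refine hdet (coeff_eq_zero_of_sum_arccos_inner_eq_zero (hO 0).1 (by simpa using hp₀.1)
      (by simpa using hq₀.1) hp₀.2 hne (fun j => by simpa using (hq j).1) hmem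
      (c := fun j => (-1) ^ ((j.succ : Fin (k + 1)) : ℕ) *
        (Matrix.of fun (i : Fin k) (l : Fin k) => Real.arccos
          ⟪p i, (Fin.cons q₀ q : Fin (k + 1) → EuclideanSpace ℝ (Fin (n + 1)))
            (j.succ.succAbove l)⟫).det) fun p' hp'O hp' => ?_)
    have := hcon (Fin.cons p' p) (Fin.cons q₀ q)
      (Fin.cases ⟨by simpa using hp', hp'O⟩ hp) (Fin.cases hq₀ hq)
    rw [Matrix.det_succ_row_zero, Fin.sum_univ_succ] at this
    rw [← this]
    congr 1
    · simp only [Fin.val_zero, pow_zero, one_mul, Matrix.of_apply, Fin.cons_zero]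
      rw [mul_comm]
      rfl
    · refine Finset.sum_congr rfl fun j _ => ?_
      rw [mul_right_comm]
      rfl
end

section
/- Let n ≥ 2 and let S^n = {p ∈ ℝ^{n+1} : ‖p‖ = 1} be the unit sphere. The squared geodesic distance kernel ψ(p,q) = arccos²(p·q) has full rank almost everywhere on S^n × S^n: for every k ∈ ℕ and every choice of nonempty relatively open subsets U_1,...,U_k ⊆ S^n and V_1,...,V_k ⊆ S^n there exist points p_i ∈ U_i and q_j ∈ V_j such that the k×k matrix (arccos²(p_i·q_j))_{i,j=1}^k is nonsingular. -/
open RealInnerProductSpace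

/-- A nonempty relatively open subset of the unit sphere is not covered by finitely many proper
subspaces. -/
theorem exists_mem_sphere_inter_forall_notMem {E : Type*} [NormedAddCommGroup E]
    [InnerProductSpace ℝ E] [FiniteDimensional ℝ E] {ι : Type*} [Finite ι]
    {O : Set E} (hO : IsOpen O) (hne : (Metric.sphere (0 : E) 1 ∩ O).Nonempty)
    (W : ι → Submodule ℝ E) (hW : ∀ i, W i ≠ ⊤) :
    ∃ x ∈ Metric.sphere (0 : E) 1 ∩ O, ∀ i, x ∉ W i := by
  borelize E
  obtain ⟨x, hx, hxO⟩ := hne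
  have hx1 : ‖x‖ = 1 := by simpa using hx
  have hx0 : x ≠ 0 := by
    rintro rfl
    simp at hx1
  have hmem : {y : E | y ≠ 0 ∧ ‖y‖⁻¹ • y ∈ O} ∈ nhds x := by
    have hc : ContinuousAt (fun y : E => ‖y‖⁻¹ • y) x :=
      (continuousAt_id.norm.inv₀ (by simpa using hx0)).smul continuousAt_id
    refine Filter.inter_mem (isOpen_ne.mem_nhds hx0) (hc (hO.mem_nhds ?_))
    simpa [hx1] using hxO
  have hpos : 0 < MeasureTheory.Measure.addHaar {y : E | y ≠ 0 ∧ ‖y‖⁻¹ • y ∈ O} :=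
    MeasureTheory.Measure.measure_pos_of_mem_nhds _ hmem
  have hnull : (MeasureTheory.Measure.addHaar : MeasureTheory.Measure E)
      (⋃ i, (W i : Set E)) = 0 :=
    MeasureTheory.measure_iUnion_null fun i =>
      MeasureTheory.Measure.addHaar_submodule _ _ (hW i)
  obtain ⟨y, ⟨hy0, hyO⟩, hyW⟩ : ∃ y ∈ {y : E | y ≠ 0 ∧ ‖y‖⁻¹ • y ∈ O},
      y ∉ ⋃ i, (W i : Set E) := by
    by_contra! h
    exact hpos.ne' (MeasureTheory.measure_mono_null h hnull)
  have hn : ‖y‖ ≠ 0 := by simpa using hy0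
  refine ⟨‖y‖⁻¹ • y, ⟨by simp [norm_smul, hn], hyO⟩, fun i hi => hyW ?_⟩
  have := (W i).smul_mem ‖y‖ hi
  rw [smul_smul, mul_inv_cancel₀ hn, one_smul] at this
  exact Set.mem_iUnion.2 ⟨i, this⟩

theorem span_pair_ne_top {E : Type*} [AddCommGroup E] [Module ℝ E]
    (hE : 3 ≤ Module.finrank ℝ E) (x y : E) : Submodule.span ℝ {x, y} ≠ ⊤ := by
  classical
  intro h
  have h1 : Module.finrank ℝ (Submodule.span ℝ {x, y}) ≤ 2 := by
    have := finrank_span_finset_le_card (R := ℝ) ({x, y} : Finset E)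
    refine le_trans ?_ (this.trans Finset.card_le_two)
    rw [Set.finrank, Finset.coe_pair]
  rw [h, finrank_top] at h1
  omega

/-- Along the great circle through `q` and `x`, the squared distances to the `r i` are analytic
and periodic, whereas the squared distance to `q` is the square of arc length. -/
theorem exists_add_sum_arccos_sq_ne_zero {E : Type*} [NormedAddCommGroup E]
    [InnerProductSpace ℝ E] {ι : Type*} [Fintype ι] {c : ℝ} (hc : c ≠ 0) (e : ι → ℝ)
    {O : Set E} (hO : IsOpen O) {x q : E} (hx : ‖x‖ = 1) (hq : ‖q‖ = 1) (hxO : x ∈ O)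
    (hxq : x ∉ Submodule.span ℝ {q}) {r : ι → E} (hr : ∀ i, ‖r i‖ = 1)
    (hrx : ∀ i, r i ∉ Submodule.span ℝ {q, x}) :
    ∃ p ∈ Metric.sphere (0 : E) 1 ∩ O,
      c * Real.arccos ⟪p, q⟫ ^ 2 + ∑ i, e i * Real.arccos ⟪p, r i⟫ ^ 2 ≠ 0 := by
  set a : ℝ := ⟪x, q⟫ with ha
  set w : E := x - a • q with hw
  have hqq : ⟪q, q⟫ = 1 := by rw [real_inner_self_eq_norm_sq, hq, one_pow]
  have hw0 : w ≠ 0 := fun h =>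
    hxq (Submodule.mem_span_singleton.2 ⟨a, (sub_eq_zero.1 h).symm⟩)
  have hwn : ‖w‖ ≠ 0 := norm_ne_zero_iff.2 hw0
  set b : E := ‖w‖⁻¹ • w with hb
  have hbn : ‖b‖ = 1 := by simp [hb, norm_smul, hwn]
  have hwq : ⟪w, q⟫ = 0 := by
    rw [hw, inner_sub_left, real_inner_smul_left, hqq, ← ha]
    ring
  have hbq : ⟪b, q⟫ = 0 := by rw [hb, real_inner_smul_left, hwq, mul_zero]
  have hqb : ⟪q, b⟫ = 0 := by rw [real_inner_comm, hbq]
  have hwx : w + a • q = x := by simp [hw]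
  have hnorm : a ^ 2 + ‖w‖ ^ 2 = 1 := by
    have h := norm_add_sq_real w (a • q)
    rw [hwx, hx, real_inner_smul_right, hwq, norm_smul, hq] at h
    simp at h
    linarith
  have hwpos : 0 < ‖w‖ := norm_pos_iff.2 hw0
  have ha1 : a ^ 2 < 1 := by nlinarith [pow_pos hwpos 2]
  have hal : -1 < a := by nlinarith
  have har : a < 1 := by nlinarith
  let γ : ℝ → E := fun t => Real.cos t • q + Real.sin t • b
  have hγn : ∀ t, ‖γ t‖ = 1 := fun t => by
    have h := norm_add_sq_real (Real.cos t • q) (Real.sin t • b)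
    rw [real_inner_smul_left, real_inner_smul_right, hqb, norm_smul, norm_smul, hq, hbn] at h
    have h2 : ‖γ t‖ ^ 2 = 1 := by
      rw [h]
      simp
    exact (pow_eq_one_iff_of_nonneg (norm_nonneg _) two_ne_zero).1 h2
  have hγq : ∀ t, ⟪γ t, q⟫ = Real.cos t := fun t => by
    simp only [γ]
    rw [inner_add_left, real_inner_smul_left, real_inner_smul_left, hqq, hbq]
    ring
  have hγW : ∀ t, γ t ∈ Submodule.span ℝ {q, x} := fun t => by
    have hqm : q ∈ Submodule.span ℝ {q, x} := Submodule.subset_span (by simp)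
    have hxm : x ∈ Submodule.span ℝ {q, x} := Submodule.subset_span (by simp)
    exact add_mem (Submodule.smul_mem _ _ hqm) (Submodule.smul_mem _ _
      (Submodule.smul_mem _ _ (sub_mem hxm (Submodule.smul_mem _ _ hqm))))
  have hγc : Continuous γ := by fun_prop
  have hcos : Real.cos (Real.arccos a) = a := Real.cos_arccos hal.le har.le
  have hγx : γ (Real.arccos a) = x := by
    have hs : Real.sin (Real.arccos a) = ‖w‖ := by
      rw [Real.sin_arccos, ← hnorm, add_sub_cancel_left, Real.sqrt_sq hwpos.le]
    simp only [γ]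
    rw [hs, hcos, hb, smul_smul, mul_inv_cancel₀ hwn, one_smul, add_comm, hwx]
  have han : AnalyticOnNhd ℝ
      (fun t => c * t ^ 2 + ∑ i, e i * Real.arccos ⟪γ t, r i⟫ ^ 2) Set.univ := by
    intro t _
    refine AnalyticAt.fun_add (by fun_prop)
      (Finset.analyticAt_fun_sum _ fun i _ => analyticAt_const.mul (AnalyticAt.pow ?_ 2))
    have h1 : ⟪γ t, r i⟫ ≠ 1 := fun h => hrx i <| by
      rw [← (inner_eq_one_iff_of_norm_eq_one (𝕜 := ℝ) (hγn t) (hr i)).1 h]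
      exact hγW t
    have h2 : ⟪γ t, r i⟫ ≠ -1 := fun h => hrx i <| by
      have := (inner_eq_neg_one_iff_of_norm_eq_one (𝕜 := ℝ) (hγn t) (hr i)).1 h
      rw [← neg_neg (r i), ← this]
      exact neg_mem (hγW t)
    refine AnalyticAt.fun_comp (g := Real.arccos) (f := fun t => ⟪γ t, r i⟫)
      (Real.contDiffAt_arccos h2 h1).analyticAt ?_
    simp only [γ, inner_add_left, real_inner_smul_left]
    exact (Real.analyticAt_cos.mul analyticAt_const).add
      (Real.analyticAt_sin.mul analyticAt_const)
  by_contra! hzero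
  have hev : (fun t => c * t ^ 2 + ∑ i, e i * Real.arccos ⟪γ t, r i⟫ ^ 2)
      =ᶠ[nhds (Real.arccos a)] fun _ => (0 : ℝ) := by
    have h1 : ∀ᶠ t in nhds (Real.arccos a), γ t ∈ O :=
      hγc.continuousAt.eventually_mem (hO.mem_nhds (by rwa [hγx]))
    have h2 : ∀ᶠ t in nhds (Real.arccos a), 0 < t :=
      eventually_gt_nhds (Real.arccos_pos.2 har)
    have h3 : ∀ᶠ t in nhds (Real.arccos a), t < Real.pi :=
      eventually_lt_nhds (lt_of_le_of_ne (Real.arccos_le_pi a) fun h => by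
        rw [h, Real.cos_pi] at hcos
        exact hal.ne hcos)
    filter_upwards [h1, h2, h3] with t ht1 ht2 ht3
    have := hzero (γ t) ⟨by simpa using hγn t, ht1⟩
    rwa [hγq, Real.arccos_cos ht2.le ht3.le] at this
  have hall := AnalyticOnNhd.eq_of_eventuallyEq han analyticOnNhd_const hev
  have h0 := congrFun hall 0
  have h2π := congrFun hall (2 * Real.pi)
  have hper : γ (2 * Real.pi) = γ 0 := by simp [γ]
  simp only [hper] at h0 h2π
  have : c * (2 * Real.pi) ^ 2 = 0 := by linarith
  exact mul_ne_zero hc (pow_ne_zero 2 Real.two_pi_pos.ne') this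

theorem stmt17 {n : ℕ} (hn : 2 ≤ n) (k : ℕ)
    (O P : Fin k → Set (EuclideanSpace ℝ (Fin (n + 1))))
    (hO : ∀ i, IsOpen (O i) ∧
      (Metric.sphere (0 : EuclideanSpace ℝ (Fin (n + 1))) 1 ∩ O i).Nonempty)
    (hP : ∀ j, IsOpen (P j) ∧
      (Metric.sphere (0 : EuclideanSpace ℝ (Fin (n + 1))) 1 ∩ P j).Nonempty) :
    ∃ p q : Fin k → EuclideanSpace ℝ (Fin (n + 1)),
      (∀ i, p i ∈ Metric.sphere (0 : EuclideanSpace ℝ (Fin (n + 1))) 1 ∩ O i) ∧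
      (∀ j, q j ∈ Metric.sphere (0 : EuclideanSpace ℝ (Fin (n + 1))) 1 ∩ P j) ∧
      (Matrix.of fun i j => Real.arccos ⟪p i, q j⟫ ^ 2).det ≠ 0 := by
  have hdim : 3 ≤ Module.finrank ℝ (EuclideanSpace ℝ (Fin (n + 1))) := by
    simp
    omega
  induction k with
  | zero => exact ⟨Fin.elim0, Fin.elim0, fun i => i.elim0, fun i => i.elim0, by simp⟩
  | succ k ih =>
    obtain ⟨p, r, hp, hr, hdet⟩ := ih (fun i => O i.succ) (fun j => P j.succ)
      (fun i => hO i.succ) (fun j => hP j.succ)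
    have hr1 : ∀ j, ‖r j‖ = 1 := fun j => by simpa using (hr j).1
    obtain ⟨q, hq, hqr⟩ := exists_mem_sphere_inter_forall_notMem (hP 0).1 (hP 0).2
      (fun j => Submodule.span ℝ {r j, r j}) fun j => span_pair_ne_top hdim _ _
    obtain ⟨x, hx, hxqr⟩ := exists_mem_sphere_inter_forall_notMem (hO 0).1 (hO 0).2
      (fun j : Option (Fin k) => Submodule.span ℝ {q, j.elim q r})
      fun j => span_pair_ne_top hdim _ _
    have hrx : ∀ j, r j ∉ Submodule.span ℝ {q, x} := fun j h => by
      obtain ⟨α, β, h⟩ := Submodule.mem_span_pair.1 h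
      by_cases hβ : β = 0
      · have hα : α ≠ 0 := by
          rintro rfl
          have := hr1 j
          simp [← h, hβ] at this
        refine hqr j (Submodule.mem_span_pair.2 ⟨α⁻¹, 0, ?_⟩)
        simp [← h, hβ, smul_smul, hα]
      · refine hxqr (some j) (Submodule.mem_span_pair.2 ⟨-(β⁻¹ * α), β⁻¹, ?_⟩)
        simp [← h, smul_smul, hβ]
    have hxq : x ∉ Submodule.span ℝ {q} := by simpa using hxqr none
    let Q : Fin (k + 1) → EuclideanSpace ℝ (Fin (n + 1)) := Fin.cons q r
    let e : Fin (k + 1) → ℝ := fun j => (-1) ^ (j : ℕ) *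
      (Matrix.of fun i l => Real.arccos ⟪p i, Q (j.succAbove l)⟫ ^ 2).det
    have he : e 0 ≠ 0 := by simpa [e, Q] using hdet
    obtain ⟨y, hy, hne⟩ := exists_add_sum_arccos_sq_ne_zero he (fun j => e j.succ) (hO 0).1
      (by simpa using hx.1) (by simpa using hq.1) hx.2 hxq hr1 hrx
    refine ⟨Fin.cons y p, Q, Fin.cases hy hp, Fin.cases hq hr, ?_⟩
    have hexp : (Matrix.of fun i j =>
        Real.arccos ⟪(Fin.cons y p : Fin (k + 1) → EuclideanSpace ℝ (Fin (n + 1))) i, Q j⟫ ^ 2).det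
          = ∑ j, e j * Real.arccos ⟪y, Q j⟫ ^ 2 := by
      rw [Matrix.det_succ_row_zero]
      refine Finset.sum_congr rfl fun j _ => ?_
      simp only [e, Matrix.of_apply, Fin.cons_zero]
      rw [mul_right_comm]
      rfl
    rw [hexp, Fin.sum_univ_succ]
    exact hne
end

section
/- For s ≥ 0 let c_s : (0,1) → ℝ be the indicator function of the interval [s/(s+1), (s+1)/(s+2)), and define ψ(x,y) = Σ_{s=0}^∞ (1/s!) c_s(x) y^s for (x,y) ∈ (0,1) × (0,1). Then the functions c_s are linearly independent in (0,1), but ψ does not have full rank almost everywhere in (0,1) × (0,1): there exist k ∈ ℕ and nonempty open sets U_1,...,U_k ⊆ (0,1) and V_1,...,V_k ⊆ (0,1) such that for all x_i ∈ U_i and y_j ∈ V_j the matrix (ψ(x_i,y_j))_{i,j=1}^k is singular. -/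
open MeasureTheory

/-- `c s` is the indicator function of the interval `[s/(s+1), (s+1)/(s+2))`. -/
noncomputable def cFun (s : ℕ) (x : ℝ) : ℝ :=
  if x ∈ Set.Ico ((s : ℝ) / (s + 1)) (((s : ℝ) + 1) / ((s : ℝ) + 2)) then 1 else 0

/-- The kernel `ψ(x,y) = Σ_{s=0}^∞ (1/s!) c_s(x) y^s`. -/
noncomputable def psiKer (x y : ℝ) : ℝ :=
  ∑' s : ℕ, (1 / (Nat.factorial s) : ℝ) * cFun s x * y ^ s

theorem cFun_eq_ite {s : ℕ} {x : ℝ}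
    (hx : x ∈ Set.Ico ((s : ℝ) / (s + 1)) (((s : ℝ) + 1) / ((s : ℝ) + 2))) (t : ℕ) :
    cFun t x = if t = s then 1 else 0 := by
  have endpoint_le : ∀ {a b : ℕ}, a < b →
      ((a : ℝ) + 1) / ((a : ℝ) + 2) ≤ (b : ℝ) / (b + 1) := by
    intro a b hab
    have hab' : (a : ℝ) + 1 ≤ b := by exact_mod_cast hab
    rw [div_le_div_iff₀ (by positivity) (by positivity)]
    nlinarith
  unfold cFun
  rcases lt_trichotomy t s with h | rfl | h
  · rw [if_neg h.ne, if_neg]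
    exact fun ht => absurd (ht.2.trans_le (endpoint_le h)) hx.1.not_gt
  · rw [if_pos hx, if_pos rfl]
  · rw [if_neg h.ne', if_neg]
    exact fun ht => absurd (hx.2.trans_le (endpoint_le h)) ht.1.not_gt

theorem psiKer_eq_of_mem {s : ℕ} {x : ℝ}
    (hx : x ∈ Set.Ico ((s : ℝ) / (s + 1)) (((s : ℝ) + 1) / ((s : ℝ) + 2))) (y : ℝ) :
    psiKer x y = y ^ s / Nat.factorial s := by
  unfold psiKer
  rw [tsum_eq_single s fun t ht => by simp [cFun_eq_ite hx, ht]]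
  simp [cFun_eq_ite hx, div_eq_inv_mul]

theorem stmt19 :
    -- the functions `c_s` are linearly independent (in the a.e. sense) in `(0,1)`
    (∀ (T : Finset ℕ) (α : ℕ → ℝ),
      (∀ᵐ x ∂(volume : Measure ℝ), x ∈ Set.Ioo (0 : ℝ) 1 →
        ∑ s ∈ T, α s * cFun s x = 0) →
      ∀ s ∈ T, α s = 0) ∧
    -- but `ψ` does not have full rank a.e. in `(0,1) × (0,1)`
    ∃ (k : ℕ) (Us Vs : Fin k → Set ℝ),
      (∀ i, IsOpen (Us i) ∧ (Us i).Nonempty ∧ Us i ⊆ Set.Ioo (0 : ℝ) 1) ∧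
      (∀ j, IsOpen (Vs j) ∧ (Vs j).Nonempty ∧ Vs j ⊆ Set.Ioo (0 : ℝ) 1) ∧
      ∀ x y : Fin k → ℝ, (∀ i, x i ∈ Us i) → (∀ j, y j ∈ Vs j) →
        (Matrix.of fun i j => psiKer (x i) (y j)).det = 0 := by
  refine ⟨fun T α hα s hs => ?_, 2, fun _ => Set.Ioo 0 (1 / 2), fun _ => Set.Ioo 0 1,
    fun _ => ⟨isOpen_Ioo, Set.nonempty_Ioo.2 (by norm_num),
      Set.Ioo_subset_Ioo_right (by norm_num)⟩,
    fun _ => ⟨isOpen_Ioo, Set.nonempty_Ioo.2 one_pos, subset_rfl⟩, fun x y hx _ => ?_⟩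
  · have hlt : (s : ℝ) / (s + 1) < ((s : ℝ) + 1) / ((s : ℝ) + 2) := by
      rw [div_lt_div_iff₀ (by positivity) (by positivity)]
      nlinarith
    have hle : ((s : ℝ) + 1) / ((s : ℝ) + 2) ≤ 1 := by
      rw [div_le_one (by positivity)]
      linarith
    obtain ⟨x, hx, hsx, hxs⟩ := (Measure.dense_of_ae hα).exists_between hlt
    have hsum := hx ⟨lt_of_le_of_lt (by positivity) hsx, hxs.trans_le hle⟩
    simpa [cFun_eq_ite ⟨hsx.le, hxs⟩, hs] using hsum
  · have hpsi : ∀ i j, psiKer (x i) (y j) = 1 := fun i j => by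
      have hmem : x i ∈ Set.Ico (((0 : ℕ) : ℝ) / ((0 : ℕ) + 1))
          ((((0 : ℕ) : ℝ) + 1) / (((0 : ℕ) : ℝ) + 2)) := by
        simpa using And.intro (hx i).1.le (hx i).2
      simp [psiKer_eq_of_mem hmem]
    simp [Matrix.det_fin_two, hpsi]
end
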